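/- Let R be a commutative ring and M an R-module generated by n elements x₁,…,xₙ. If Z is an n×n matrix over R whose columns are relations among the generators (i.e. Σᵢ xᵢ Z_{ij} = 0 for every j), then (det Z)·xᵢ = 0 for all i; in particular det Z ∈ ann_R M. Consequently, if F₀(M) denotes the ideal generated by all such determinants of n×n relation matrices (the 0-th Fitting ideal), then (ann_R M)ⁿ ⊆ F₀(M) ⊆ ann_R M. -/

import Mathlib

open Matrix

open scoped Pointwise in
theorem pow_le_of_prod_mem {R : Type*} [CommRing R] (I J : Ideal R) (n : ℕ)
    (h : ∀ f : Fin n → I, ∏ i, (f i : R) ∈ J) : I ^ n ≤ J := by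
  have hp : I ^ n = Ideal.span ((I : Set R) ^ n) := Submodule.pow_eq_span_pow_set _ n
  rw [hp, Ideal.span_le]
  intro r hr
  obtain ⟨f, hf⟩ := Set.mem_pow.1 hr
  rw [← hf, List.prod_ofFn]
  exact h f

/-- Let `M` be an `R`-module generated by `x₁,…,xₙ`.  If `Z` is an `n×n` matrix of
relations among the generators (`Σᵢ xᵢ Z_{ij} = 0` for all `j`), then `(det Z)·xᵢ = 0`
for all `i`; in particular `det Z ∈ ann_R M`.  Consequently, the 0-th Fitting ideal
`F₀(M)` (generated by determinants of all such relation matrices) satisfies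
`(ann_R M)ⁿ ⊆ F₀(M) ⊆ ann_R M`. -/
theorem statement_10 (R : Type*) [CommRing R] (M : Type*) [AddCommGroup M] [Module R M]
    (n : ℕ) (x : Fin n → M) (hgen : Submodule.span R (Set.range x) = ⊤) :
    (∀ Z : Matrix (Fin n) (Fin n) R,
      (∀ j, ∑ i, Z i j • x i = 0) → ∀ i, Z.det • x i = 0) ∧
    (⊤ : Submodule R M).annihilator ^ n ≤
      Ideal.span {r | ∃ Z : Matrix (Fin n) (Fin n) R,
        (∀ j, ∑ i, Z i j • x i = 0) ∧ r = Z.det} ∧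
    Ideal.span {r | ∃ Z : Matrix (Fin n) (Fin n) R,
        (∀ j, ∑ i, Z i j • x i = 0) ∧ r = Z.det} ≤
      (⊤ : Submodule R M).annihilator := by
  have key : ∀ Z : Matrix (Fin n) (Fin n) R,
      (∀ j, ∑ i, Z i j • x i = 0) → ∀ i, Z.det • x i = 0 := by
    intro Z hZ i
    have h1 : ∑ k, (Z * Z.adjugate) k i • x k = Z.det • x i := by
      rw [Matrix.mul_adjugate]
      simp [Matrix.one_apply, ite_smul]
    rw [← h1]
    simp only [Matrix.mul_apply, Finset.sum_smul]
    rw [Finset.sum_comm]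
    refine Finset.sum_eq_zero fun j _ => ?_
    have h2 : ∀ k, (Z k j * Z.adjugate j i) • x k = Z.adjugate j i • (Z k j • x k) := by
      intro k
      rw [smul_smul, mul_comm]
    simp only [h2]
    rw [← Finset.smul_sum, hZ j, smul_zero]
  refine ⟨key, ?_, ?_⟩
  · refine pow_le_of_prod_mem _ _ n ?_
    intro f
    refine Ideal.subset_span ?_
    refine ⟨Matrix.diagonal fun i => (f i : R), ?_, ?_⟩
    · intro j
      refine Finset.sum_eq_zero fun i _ => ?_
      by_cases h : i = j
      · subst h
        rw [Matrix.diagonal_apply_eq]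
        exact Submodule.mem_annihilator.1 (f i).2 _ trivial
      · rw [Matrix.diagonal_apply_ne _ h, zero_smul]
    · rw [Matrix.det_diagonal]
  · rw [Ideal.span_le]
    rintro r ⟨Z, hZ, rfl⟩
    rw [← hgen]
    refine (Submodule.mem_annihilator_span _ _).2 ?_
    rintro ⟨_, i, rfl⟩
    exact key Z hZ i
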